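/- There exist constants c₁, c₂ > 0 and n₀ ∈ ℕ such that for all n > n₀, the Shannon gate complexity function for reversible circuits without additional inputs satisfies c₁·n·2ⁿ/log₂ n ≤ L(n,0) ≤ c₂·n·2ⁿ/log₂ n, i.e. L(n,0) ≍ n·2ⁿ/log₂ n. -/

import Mathlib

namespace RevCirc

/-- A reversible gate on `n` wires: a target coordinate together with a set of
at most two control coordinates not containing the target.  With no controls it
is a NOT gate, with one control a CNOT gate and with two controls a 2-CNOT
(Toffoli) gate. -/
abbrev Gate (n : ℕ) : Type :=
  {p : Fin n × Finset (Fin n) // p.2.card ≤ 2 ∧ p.1 ∉ p.2}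

def Gate.target {n : ℕ} (g : Gate n) : Fin n := g.1.1

def Gate.controls {n : ℕ} (g : Gate n) : Finset (Fin n) := g.1.2

/-- The transformation of `ℤ₂ⁿ` defined by a gate: the target coordinate is
XOR-ed with the conjunction of the control coordinates. -/
def Gate.apply {n : ℕ} (g : Gate n) (x : Fin n → Bool) : Fin n → Bool :=
  fun i => if i = g.target then xor (x i) (decide (∀ j ∈ g.controls, x j = true)) else x i

/-- The transformation defined by a circuit (a list of gates, applied left to right). -/
def evalCircuit {n : ℕ} (c : List (Gate n)) (x : Fin n → Bool) : Fin n → Bool :=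
  c.foldl (fun y g => g.apply y) x

/-- A circuit realizes a permutation `h` of `ℤ₂ⁿ` (without additional inputs) if the
composition of its gates equals `h`. -/
def realizes {n : ℕ} (c : List (Gate n)) (h : Equiv.Perm (Fin n → Bool)) : Prop :=
  ∀ x, evalCircuit c x = h x

/-- The expanding function `ℤ₂ⁿ → ℤ₂^{n+q}` padding with zeros. -/
def expand (n q : ℕ) (x : Fin n → Bool) : Fin (n + q) → Bool :=
  fun i => if h : (i : ℕ) < n then x ⟨i, h⟩ else false

/-- A circuit with `n+q` inputs implements `f : ℤ₂ⁿ → ℤ₂ⁿ` using `q` additional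
inputs if for some permutation `π` of the wires, the coordinates `π(1),…,π(n)` of the
output on the zero-padded input give `f`. -/
def implements (n q : ℕ) (c : List (Gate (n + q)))
    (f : (Fin n → Bool) → (Fin n → Bool)) : Prop :=
  ∃ π : Equiv.Perm (Fin (n + q)), ∀ x : Fin n → Bool, ∀ i : Fin n,
    evalCircuit c (expand n q x) (π (Fin.castLE (Nat.le_add_right n q) i)) = f x i

/-- `F(n,q)`: the set of transformations `ℤ₂ⁿ → ℤ₂ⁿ` implementable by reversible
circuits with `n+q` inputs. -/
def FSet (n q : ℕ) : Set ((Fin n → Bool) → (Fin n → Bool)) :=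
  {f | ∃ c : List (Gate (n + q)), implements n q c f}

/-- The set of wires touched by a gate: its target together with its controls. -/
def Gate.support {n : ℕ} (g : Gate n) : Finset (Fin n) := insert g.target g.controls

/-- A circuit has depth 1 if the supports of its gates are pairwise disjoint. -/
def DepthOne {n : ℕ} (c : List (Gate n)) : Prop :=
  c.Pairwise fun g₁ g₂ => Disjoint g₁.support g₂.support

/-- The depth of a circuit: the minimal number of consecutive depth-1 sub-circuits
into which it can be divided. -/
noncomputable def depth {n : ℕ} (c : List (Gate n)) : ℕ :=
  sInf {d | ∃ parts : List (List (Gate n)),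
    parts.flatten = c ∧ (∀ p ∈ parts, DepthOne p) ∧ parts.length = d}

/-- The quantum weight of a circuit: each NOT and CNOT gate weighs `WC`, each
2-CNOT gate weighs `WT`. -/
def weight {n : ℕ} (WC WT : ℝ) (c : List (Gate n)) : ℝ :=
  (c.map fun g => if g.controls.card = 2 then WT else WC).sum

/-- `L(f,q)`: minimal gate complexity of a circuit implementing `f` with `q`
additional inputs. -/
noncomputable def Lmin (n q : ℕ) (f : (Fin n → Bool) → (Fin n → Bool)) : ℕ :=
  sInf {l | ∃ c : List (Gate (n + q)), implements n q c f ∧ c.length = l}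

/-- The Shannon gate complexity function `L(n,q)`. -/
noncomputable def ShannonL (n q : ℕ) : ℕ := sSup (Lmin n q '' FSet n q)

/-- `D(f,q)`: minimal depth of a circuit implementing `f` with `q` additional inputs. -/
noncomputable def Dmin (n q : ℕ) (f : (Fin n → Bool) → (Fin n → Bool)) : ℕ :=
  sInf {d | ∃ c : List (Gate (n + q)), implements n q c f ∧ depth c = d}

/-- The Shannon depth function `D(n,q)`. -/
noncomputable def ShannonD (n q : ℕ) : ℕ := sSup (Dmin n q '' FSet n q)

/-- `W(f,q)`: minimal quantum weight of a circuit implementing `f` with `q`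
additional inputs. -/
noncomputable def Wmin (WC WT : ℝ) (n q : ℕ) (f : (Fin n → Bool) → (Fin n → Bool)) : ℝ :=
  sInf {w | ∃ c : List (Gate (n + q)), implements n q c f ∧ weight WC WT c = w}

/-- The Shannon quantum weight function `W(n,q)`. -/
noncomputable def ShannonW (WC WT : ℝ) (n q : ℕ) : ℝ := sSup (Wmin WC WT n q '' FSet n q)

/-- A permutation is a product of `K` pairwise disjoint (independent) transpositions:
there are `2K` pairwise distinct points `x i, y i` with `g = (x 1, y 1)∘⋯∘(x K, y K)`. -/
def IsProdOfDisjointTranspositions {X : Type*} [DecidableEq X] (K : ℕ)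
    (g : Equiv.Perm X) : Prop :=
  ∃ x y : Fin K → X,
    Function.Injective (Sum.elim x y) ∧
    g = ((List.finRange K).map fun i => Equiv.swap (x i) (y i)).prod

end RevCirc


namespace RevCirc

/-- Generalized multi-controlled NOT. -/
def mc {n : ℕ} (A : Finset (Fin n)) (t : Fin n) (x : Fin n → Bool) : Fin n → Bool :=
  fun i => if i = t then xor (x i) (decide (∀ j ∈ A, x j = true)) else x i

/-- `f` is computed by a circuit of at most `l` gates. -/
def Rf {n : ℕ} (f : (Fin n → Bool) → (Fin n → Bool)) (l : ℕ) : Prop :=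
  ∃ c : List (Gate n), evalCircuit c = f ∧ c.length ≤ l

theorem Rf.id' {n : ℕ} : Rf (id : (Fin n → Bool) → (Fin n → Bool)) 0 :=
  ⟨[], by funext x; rfl, le_rfl⟩

theorem Rf.mono {n : ℕ} {f : (Fin n → Bool) → (Fin n → Bool)} {a b : ℕ} (h : Rf f a) (hab : a ≤ b) :
    Rf f b := by
  obtain ⟨c, hc, hl⟩ := h
  exact ⟨c, hc, hl.trans hab⟩

theorem evalCircuit_append {n : ℕ} (c d : List (Gate n)) (x : Fin n → Bool) :
    evalCircuit (c ++ d) x = evalCircuit d (evalCircuit c x) := by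
  simp [evalCircuit]

theorem Rf.comp {n : ℕ} {f g : (Fin n → Bool) → (Fin n → Bool)} {a b : ℕ} (hf : Rf f a) (hg : Rf g b) :
    Rf (g ∘ f) (a + b) := by
  obtain ⟨c, hc, hl⟩ := hf
  obtain ⟨d, hd, hm⟩ := hg
  refine ⟨c ++ d, ?_, ?_⟩
  · funext x
    rw [evalCircuit_append, hc, hd]; rfl
  · simp; omega

theorem Rf_mc {n : ℕ} {A : Finset (Fin n)} {t : Fin n} (hA : A.card ≤ 2) (ht : t ∉ A) :
    Rf (mc A t) 1 :=
  ⟨[⟨(t, A), hA, ht⟩], by funext x; rfl, by simp⟩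

theorem gate_apply_eq {n : ℕ} (g : Gate n) : g.apply = mc g.controls g.target := rfl

theorem mc_mc {n : ℕ} {A : Finset (Fin n)} {t : Fin n} (ht : t ∉ A) (x : Fin n → Bool) :
    mc A t (mc A t x) = x := by
  have h : ∀ j ∈ A, mc A t x j = x j := by
    intro j hj
    have : j ≠ t := fun h => ht (h ▸ hj)
    simp [mc, this]
  have h2 : (∀ j ∈ A, mc A t x j = true) ↔ (∀ j ∈ A, x j = true) :=
    forall₂_congr fun j hj => by rw [h j hj]
  funext i
  by_cases hi : i = t
  · subst hi
    have e : mc A i (mc A i x) i = xor (mc A i x i) (decide (∀ j ∈ A, mc A i x j = true)) := by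
      simp only [mc, if_true]
    rw [e]
    simp only [h2]
    simp [mc]
  · simp [mc, hi]

theorem gate_invol {n : ℕ} (g : Gate n) (x : Fin n → Bool) : g.apply (g.apply x) = x := by
  rw [gate_apply_eq]; exact mc_mc g.2.2 x

theorem eval_reverse {n : ℕ} (c : List (Gate n)) (x : Fin n → Bool) :
    evalCircuit c.reverse (evalCircuit c x) = x := by
  induction c generalizing x with
  | nil => rfl
  | cons g c ih =>
    rw [List.reverse_cons, evalCircuit_append]
    have : evalCircuit (g :: c) x = evalCircuit c (g.apply x) := rfl
    rw [this, ih]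
    exact gate_invol g x

theorem eval_reverse' {n : ℕ} (c : List (Gate n)) (x : Fin n → Bool) :
    evalCircuit c (evalCircuit c.reverse x) = x := by
  have := eval_reverse c.reverse x
  rwa [List.reverse_reverse] at this

/-- The permutation of a circuit. -/
def circPerm {n : ℕ} (c : List (Gate n)) : Equiv.Perm (Fin n → Bool) where
  toFun := evalCircuit c
  invFun := evalCircuit c.reverse
  left_inv := eval_reverse c
  right_inv := eval_reverse' c

/-- A permutation is realized with at most `l` gates. -/
def Rp {n : ℕ} (σ : Equiv.Perm (Fin n → Bool)) (l : ℕ) : Prop := Rf (σ : _ → _) l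

theorem Rf.perm {n : ℕ} {f : (Fin n → Bool) → (Fin n → Bool)} {l : ℕ} (h : Rf f l) :
    ∃ σ : Equiv.Perm (Fin n → Bool), Rp σ l ∧ ∀ x, σ x = f x := by
  obtain ⟨c, hc, hl⟩ := h
  exact ⟨circPerm c, ⟨c, rfl, hl⟩, fun x => by rw [← hc]; rfl⟩

theorem Rp.mul {n : ℕ} {σ τ : Equiv.Perm (Fin n → Bool)} {a b : ℕ} (hs : Rp σ a) (ht : Rp τ b) :
    Rp (σ * τ) (a + b) := by
  have := Rf.comp ht hs
  exact this.mono (by omega)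

theorem Rp.one {n : ℕ} : Rp (1 : Equiv.Perm (Fin n → Bool)) 0 := Rf.id'

theorem Rp.inv {n : ℕ} {σ : Equiv.Perm (Fin n → Bool)} {a : ℕ} (hs : Rp σ a) : Rp σ⁻¹ a := by
  obtain ⟨c, hc, hl⟩ := hs
  refine ⟨c.reverse, ?_, by simpa using hl⟩
  funext x
  rw [Equiv.Perm.eq_inv_iff_eq, ← hc]
  exact eval_reverse' c x

/-- One layer of gates with targets in `J` and controls outside `J`. -/
theorem Rf_layer {n : ℕ} (c : Fin n → Finset (Fin n)) (J : Finset (Fin n))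
    (hc : ∀ j ∈ J, (c j).card ≤ 2 ∧ Disjoint (c j) J) :
    Rf (fun (x : Fin n → Bool) j =>
      if j ∈ J then xor (x j) (decide (∀ i ∈ c j, x i = true)) else x j) J.card := by
  induction J using Finset.induction_on with
  | empty =>
    simp only [Finset.notMem_empty, if_false, Finset.card_empty]
    exact Rf.id'
  | insert a J ha ih =>
    have ih' := ih (fun j hj => ⟨(hc j (Finset.mem_insert_of_mem hj)).1,
      (hc j (Finset.mem_insert_of_mem hj)).2.mono_right (Finset.subset_insert _ _)⟩)
    have h1 := hc a (Finset.mem_insert_self _ _)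
    have ha' : a ∉ c a := fun h => Finset.disjoint_left.mp h1.2 h (Finset.mem_insert_self _ _)
    have := ih'.comp (Rf_mc h1.1 ha')
    rw [Finset.card_insert_of_notMem ha]
    convert this using 1
    funext x i
    have key : (∀ j ∈ c a, (if j ∈ J then xor (x j) (decide (∀ i ∈ c j, x i = true)) else x j) = true) ↔
        (∀ j ∈ c a, x j = true) := by
      refine forall₂_congr fun j hj => ?_
      have : j ∉ J := fun h => Finset.disjoint_left.mp h1.2 hj (Finset.mem_insert_of_mem h)
      rw [if_neg this]
    by_cases hi : i = a
    · subst hi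
      simp only [Function.comp, mc, if_true, Finset.mem_insert_self, ha, if_false]
      rw [decide_eq_decide.mpr key]
    · simp [mc, hi]

/-- The flips made by the ladder. -/
def flips {n : ℕ} : List (Fin n) → List (Fin n) → Fin n → (Fin n → Bool) → (Fin n → Bool)
  | [], _, t, _ => fun i => decide (i = t)
  | _ :: _, [], _, _ => fun _ => false
  | a :: as, d :: ds, t, x => fun i =>
      xor (decide (i = t) && decide (∀ j ∈ a :: as, x j = true)) (flips as ds d x i)

theorem flips_out {n : ℕ} (as ds : List (Fin n)) (t : Fin n) (x : Fin n → Bool) (i : Fin n)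
    (hi : i ≠ t) (hd : i ∉ ds) : flips as ds t x i = false := by
  induction as generalizing ds t with
  | nil => simp [flips, hi]
  | cons a as ih =>
    cases ds with
    | nil => simp [flips]
    | cons d ds =>
      simp only [List.mem_cons, not_or] at hd
      simp [flips, hi, ih ds d hd.1 hd.2]

theorem flips_at {n : ℕ} (as ds : List (Fin n)) (t : Fin n) (x : Fin n → Bool)
    (hl : as.length ≤ ds.length) (hd : t ∉ ds) :
    flips as ds t x t = decide (∀ j ∈ as, x j = true) := by
  cases as with
  | nil => simp [flips]
  | cons a as =>
    cases ds with
    | nil => simp at hl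
    | cons d ds =>
      simp only [List.mem_cons, not_or] at hd
      simp only [flips]
      rw [flips_out as ds d x t hd.1 hd.2]
      simp

theorem flips_congr {n : ℕ} (as ds : List (Fin n)) (t : Fin n) (x y : Fin n → Bool)
    (h : ∀ j ∈ as, x j = y j) : flips as ds t x = flips as ds t y := by
  induction as generalizing ds t with
  | nil => simp [flips]
  | cons a as ih =>
    cases ds with
    | nil => simp [flips]
    | cons d ds =>
      have e : (∀ j ∈ a :: as, x j = true) ↔ (∀ j ∈ a :: as, y j = true) :=
        forall₂_congr fun j hj => by rw [h j hj]
      simp only [flips]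
      rw [decide_eq_decide.mpr e, ih ds d (fun j hj => h j (List.mem_cons_of_mem _ hj))]

/-- The shear map of the ladder. -/
def lad {n : ℕ} (as ds : List (Fin n)) (t : Fin n) (x : Fin n → Bool) : Fin n → Bool :=
  fun i => xor (x i) (flips as ds t x i)

theorem Rf_lad {n : ℕ} (as ds : List (Fin n)) (t : Fin n) (hl : as.length ≤ ds.length)
    (hn : (as ++ t :: ds).Nodup) : Rf (lad as ds t) (2 * as.length + 1) := by
  induction as generalizing ds t with
  | nil =>
    have := Rf_mc (n := n) (A := ∅) (t := t) (by simp) (by simp)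
    refine (?_ : Rf _ 1).mono (by simp)
    convert this using 1
    funext x i
    by_cases h : i = t <;> simp [lad, flips, mc, h]
  | cons a as ih =>
    cases ds with
    | nil => simp at hl
    | cons d ds =>
      simp only [List.cons_append, List.nodup_cons, List.mem_append, List.mem_cons, not_or,
        List.nodup_append] at hn
      obtain ⟨⟨haas, hat, had, hads⟩, hnas, ⟨⟨htd, htds⟩, hdds, hnds⟩, hdis⟩ := hn
      have htas : t ∉ as := fun h => hdis t h t (Or.inl rfl) rfl
      have ih' := ih ds d (by simpa using hl) (by
        simp only [List.nodup_append, List.nodup_cons, List.mem_cons]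
        exact ⟨hnas, ⟨hdds, hnds⟩, fun u hu v hv => hdis u hu v (Or.inr hv)⟩)
      have hU := Rf_mc (n := n) (A := {a, d}) (t := t) (Finset.card_le_two) (by
        simp; exact ⟨fun h => hat h.symm, htd⟩)
      have := (hU.comp ih').comp hU
      refine Rf.mono ?_ (show 1 + (2 * as.length + 1) + 1 ≤ _ by simp; omega)
      convert this using 1
      funext x i
      have e1 : flips as ds d (mc {a, d} t x) = flips as ds d x := by
        apply flips_congr
        intro j hj
        have : j ≠ t := fun h => htas (h ▸ hj)
        simp [mc, this]
      have e2 : flips as ds d x d = decide (∀ j ∈ as, x j = true) :=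
        flips_at as ds d x (by simpa using hl) hdds
      have e3 : flips as ds d x a = false := flips_out as ds d x a had hads
      have e4 : flips as ds d x t = false := flips_out as ds d x t htd htds
      have hdt : d ≠ t := fun h => htd h.symm
      simp only [Function.comp]
      by_cases hi : i = t
      · subst hi
        have e5 : mc {a, d} i (lad as ds d (mc {a, d} i x)) i =
            xor (lad as ds d (mc {a, d} i x) i) (lad as ds d (mc {a, d} i x) a && lad as ds d (mc {a, d} i x) d) := by
          simp [mc]
        rw [e5]
        simp only [lad, e1, e2, e3, e4]
        simp only [flips, e4, mc, if_neg hat, if_neg hdt]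
        simp
        cases x i <;> cases x a <;> cases x d <;> simp
      · simp [lad, flips, hi, mc, e1]

theorem Rf_mc_list {n : ℕ} (as ds : List (Fin n)) (t : Fin n) (hl : as.length ≤ ds.length)
    (hn : (as ++ t :: ds).Nodup) : Rf (mc as.toFinset t) (4 * as.length + 1) := by
  cases as with
  | nil => exact Rf_mc (by simp) (by simp)
  | cons a as =>
    cases ds with
    | nil => simp at hl
    | cons d ds =>
      have h1 := Rf_lad (a :: as) (d :: ds) t hl hn
      simp only [List.cons_append, List.nodup_cons, List.mem_append, List.mem_cons, not_or,
        List.nodup_append] at hn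
      obtain ⟨⟨haas, hat, had, hads⟩, hnas, ⟨⟨htd, htds⟩, hdds, hnds⟩, hdis⟩ := hn
      have h2 := Rf_lad as ds d (by simpa using hl) (by
        simp only [List.nodup_append, List.nodup_cons, List.mem_cons]
        exact ⟨hnas, ⟨hdds, hnds⟩, fun u hu v hv => hdis u hu v (Or.inr hv)⟩)
      have := h2.comp h1
      refine Rf.mono ?_ (show (2 * as.length + 1) + (2 * (a :: as).length + 1) ≤ _ by simp; omega)
      convert this using 1
      funext x i
      have hag : ∀ j ∈ a :: as, lad as ds d x j = x j := by
        intro j hj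
        have : flips as ds d x j = false := by
          apply flips_out
          · rintro rfl
            rcases List.mem_cons.mp hj with h | h
            · exact had h.symm
            · exact hdis j h j (Or.inr (Or.inl rfl)) rfl
          · intro h'
            rcases List.mem_cons.mp hj with h | h
            · exact hads (h ▸ h')
            · exact hdis j h j (Or.inr (Or.inr h')) rfl
        simp [lad, this]
      have e0 : lad (a :: as) (d :: ds) t (lad as ds d x) i =
          xor (lad as ds d x i) (flips (a :: as) (d :: ds) t x i) := by
        simp only [lad]
        rw [← flips_congr (a :: as) (d :: ds) t _ x hag]
      simp only [Function.comp]
      rw [e0]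
      simp only [lad, flips, mc]
      by_cases hi : i = t
      · subst hi
        have e4 : flips as ds d x i = false := flips_out as ds d x i htd htds
        simp [e4]
      · simp [hi]

theorem Rf_mc_dirty {n : ℕ} (A D : Finset (Fin n)) (t : Fin n) (hl : A.card ≤ D.card)
    (htA : t ∉ A) (htD : t ∉ D) (hAD : Disjoint A D) : Rf (mc A t) (4 * A.card + 1) := by
  have := Rf_mc_list A.toList D.toList t (by simpa using hl) (by
    simp only [List.nodup_append, List.nodup_cons, Finset.mem_toList, List.mem_cons]
    refine ⟨A.nodup_toList, ⟨htD, D.nodup_toList⟩, ?_⟩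
    rintro a ha b (rfl | hb) rfl
    · exact htA ha
    · exact Finset.disjoint_left.mp hAD ha hb)
  simpa using this

theorem mc_comm {n : ℕ} (A B : Finset (Fin n)) (d t : Fin n) (hdt : d ≠ t)
    (hdA : d ∉ A) (hdB : d ∉ B) (htA : t ∉ A) (htB : t ∉ B) :
    mc (A ∪ B) t = mc A d ∘ mc (insert d B) t ∘ mc A d ∘ mc (insert d B) t := by
  have H : ∀ (C E : Finset (Fin n)) (s : Fin n) (y : Fin n → Bool), s ∉ C →
      ((∀ j ∈ C, mc E s y j = true) ↔ (∀ j ∈ C, y j = true)) := by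
    intro C E s y hs
    refine forall₂_congr fun j hj => ?_
    have : j ≠ s := fun h => hs (h ▸ hj)
    simp [mc, this]
  have mt : ∀ (C : Finset (Fin n)) (s : Fin n) (y : Fin n → Bool), mc C s y s = xor (y s) (decide (∀ j ∈ C, y j = true)) := by
    intro C s y; simp [mc]
  have mo : ∀ (C : Finset (Fin n)) (s i : Fin n) (y : Fin n → Bool), i ≠ s → mc C s y i = y i := by
    intro C s i y h; simp [mc, h]
  funext x i
  simp only [Function.comp]
  by_cases hi : i = t
  · subst hi
    rw [mt (A ∪ B), mo A d i _ (Ne.symm hdt), mt (insert d B), mo A d i _ (Ne.symm hdt), mt (insert d B)]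
    simp only [Finset.forall_mem_insert, Finset.forall_mem_union, H B _ _ _ hdB, H B _ _ _ htB,
      H A _ _ _ htA, mt, mo _ i d _ hdt]
    simp only [Bool.decide_and, Bool.decide_eq_true]
    generalize decide (∀ j ∈ A, x j = true) = P
    generalize decide (∀ j ∈ B, x j = true) = Q
    cases x i <;> cases x d <;> cases P <;> cases Q <;> rfl
  · rw [mo _ t i _ hi]
    by_cases hid : i = d
    · subst hid
      rw [mt, mo _ t i _ hi, mt, mo _ t i _ hi]
      simp only [H A _ _ _ htA, H A _ _ _ hdA]
      simp
    · rw [mo _ d i _ hid, mo _ t i _ hi, mo _ d i _ hid, mo _ t i _ hi]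

theorem Rf_mc_big {n : ℕ} (A : Finset (Fin n)) (t d e : Fin n) (htA : t ∉ A) (hdA : d ∉ A)
    (heA : e ∉ A) (hdt : d ≠ t) (het : e ≠ t) (hed : e ≠ d) : Rf (mc A t) (8 * n + 12) := by
  obtain ⟨B, hBA, hB⟩ := Finset.exists_subset_card_eq (s := A) (n := A.card / 2) (by omega)
  have hcard : (A \ B).card = A.card - A.card / 2 := by
    rw [Finset.card_sdiff_of_subset hBA, hB]
  have hA : A.card ≤ n := by simpa using Finset.card_le_univ A
  have htB : t ∉ B := fun h => htA (hBA h)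
  have hdB : d ∉ B := fun h => hdA (hBA h)
  have heB : e ∉ B := fun h => heA (hBA h)
  have hc := mc_comm (A \ B) B d t hdt (by simp [hdA]) hdB (by simp [htA]) htB
  rw [Finset.sdiff_union_of_subset hBA] at hc
  have h1 := Rf_mc_dirty (A \ B) (insert t B) d (by
    rw [Finset.card_insert_of_notMem htB]; omega) (by simp [hdA]) (by simp [hdt, hdB]) (by
    rw [Finset.disjoint_insert_right]
    exact ⟨by simp [htA], Finset.sdiff_disjoint⟩)
  have h2 := Rf_mc_dirty (insert d B) (insert e (A \ B)) t (by
    rw [Finset.card_insert_of_notMem hdB, Finset.card_insert_of_notMem (by simp [heA])]; omega)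
    (by simp [hdt.symm, htB]) (by simp [het.symm, htA]) (by
    rw [Finset.disjoint_insert_right, Finset.disjoint_insert_left]
    exact ⟨by simp [hed, heB], by simp [hdA], Finset.disjoint_sdiff⟩)
  rw [hc]
  refine (((h2.comp h1).comp h2).comp h1).mono ?_
  rw [Finset.card_insert_of_notMem hdB]
  omega

end RevCirc

namespace RevCirc

theorem sign_mc {n : ℕ} (hn : 4 ≤ n) (g : Gate n) (σ : Equiv.Perm (Fin n → Bool))
    (hσ : ∀ x, σ x = g.apply x) : Equiv.Perm.sign σ = 1 := by
  obtain ⟨⟨t, C⟩, hC, ht⟩ := g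
  have hcard : (insert t C).card < (Finset.univ : Finset (Fin n)).card := by
    have := Finset.card_insert_le t C
    simp at hC ⊢
    omega
  obtain ⟨d, -, hd⟩ := Finset.exists_mem_notMem_of_card_lt_card hcard
  simp only [Finset.mem_insert, not_or] at hd
  simp only at ht
  let α : Equiv.Perm (Fin n → Bool) := ⟨mc C d, mc C d, mc_mc hd.2, mc_mc hd.2⟩
  have htd : t ∉ ({d} : Finset (Fin n)) := by simp; exact fun h => hd.1 h.symm
  let β : Equiv.Perm (Fin n → Bool) := ⟨mc {d} t, mc {d} t, mc_mc htd, mc_mc htd⟩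
  have : σ = α * β * α * β := by
    ext1 x
    rw [hσ]
    have h := mc_comm C ∅ d t hd.1 hd.2 (by simp) ht (by simp)
    rw [Finset.union_empty] at h
    change mc C t x = _
    rw [h]
    rfl
  rw [this]
  simp only [map_mul]
  rcases Int.units_eq_one_or (Equiv.Perm.sign α) with h | h <;>
  rcases Int.units_eq_one_or (Equiv.Perm.sign β) with h' | h' <;> simp [h, h']

theorem sign_circ {n : ℕ} (hn : 4 ≤ n) (c : List (Gate n)) (σ : Equiv.Perm (Fin n → Bool))
    (hσ : ∀ x, σ x = evalCircuit c x) : Equiv.Perm.sign σ = 1 := by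
  induction c generalizing σ with
  | nil =>
    have : σ = 1 := by ext1 x; rw [hσ]; rfl
    simp [this]
  | cons g c ih =>
    have : σ = circPerm c * circPerm [g] := by
      ext1 x; rw [hσ]; rfl
    rw [this, map_mul, ih (circPerm c) (fun x => rfl), sign_mc hn g (circPerm [g]) (fun x => rfl)]
    simp

theorem Rp.sign {n : ℕ} (hn : 4 ≤ n) {σ : Equiv.Perm (Fin n → Bool)} {l : ℕ} (h : Rp σ l) :
    Equiv.Perm.sign σ = 1 := by
  obtain ⟨c, hc, -⟩ := h
  exact sign_circ hn c σ (fun x => by rw [hc])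

/-- `z` vanishes outside `S`. -/
def SuppIn {n : ℕ} (S : Finset (Fin n)) (z : Fin n → Bool) : Prop := ∀ j, j ∉ S → z j = false

theorem small_swap {n : ℕ} (S D : Finset (Fin n)) (hD : S.card ≤ D.card) (hSD : Disjoint S D)
    (a b : Fin n → Bool) (ha : SuppIn S a) (hb : SuppIn S b) (hab : a ≠ b) :
    ∃ T : Equiv.Perm (Fin n → Bool), Rp T (8 * S.card + 1) ∧
      ∀ z, SuppIn S z → T z = Equiv.swap a b z := by
  classical
  obtain ⟨t, ht⟩ : ∃ t, a t ≠ b t := Function.ne_iff.mp hab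
  have htS : t ∈ S := by
    by_contra h
    exact ht (by rw [ha t h, hb t h])
  set J1 : Finset (Fin n) := S.filter fun j => (j ≠ t ∧ a j = false) ∨ (j = t ∧ a j = true) with hJ1
  set J2 : Finset (Fin n) := S.filter fun j => j ≠ t ∧ a j ≠ b j with hJ2
  have h1 := Rf_layer (n := n) (fun _ => ∅) J1 (by simp)
  have h2 := Rf_layer (n := n) (fun _ => {t}) J2 (by simp [hJ2])
  obtain ⟨β, hβ, hβe⟩ := (h1.comp h2).perm
  have hc1 : J1.card ≤ S.card := Finset.card_filter_le _ _
  have hc2 : J2.card ≤ S.card := Finset.card_filter_le _ _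
  have hM := Rf_mc_dirty (S.erase t) D t ((Finset.card_erase_le).trans hD) (by simp)
    (fun h => Finset.disjoint_left.mp hSD htS h)
    (hSD.mono_left (Finset.erase_subset _ _))
  obtain ⟨M, hM, hMe⟩ := hM.perm
  have hce : (S.erase t).card + 1 = S.card := Finset.card_erase_add_one htS
  have hβ' : ∀ z j, β z j = xor (xor (z j) (decide (j ∈ J1)))
      (decide (j ∈ J2) && xor (z t) (decide (t ∈ J1))) := by
    intro z j
    rw [hβe]
    simp only [Function.comp]
    by_cases h : j ∈ J1 <;> by_cases h' : j ∈ J2 <;> by_cases h'' : t ∈ J1 <;> simp [h, h', h'']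
  have hout : ∀ z, SuppIn S z → ∀ j, j ∉ S → β z j = false := by
    intro z hz j hj
    have : j ∉ J1 := fun h => hj (Finset.mem_filter.mp h).1
    have h' : j ∉ J2 := fun h => hj (Finset.mem_filter.mp h).1
    rw [hβ']
    simp [this, h', hz j hj]
  have hβa : ∀ j ∈ S, β a j = decide (j ≠ t) := by
    intro j hj
    rw [hβ']
    by_cases hjt : j = t
    · subst hjt
      cases h : a j <;> simp [hJ1, hJ2, hj, h]
    · cases h : a j <;> cases h' : a t <;> simp [hJ1, hJ2, hj, h, htS, h', hjt]
  have hβb : ∀ j ∈ S, β b j = true := by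
    intro j hj
    rw [hβ']
    by_cases hjt : j = t
    · subst hjt
      cases h : a j <;> cases h2 : b j <;> simp_all
    · cases h : a j <;> cases h' : a t <;> cases h2 : b j <;> cases h3 : b t <;>
        simp_all
  have hMab : M (β a) = β b := by
    rw [hMe]
    funext j
    have : ∀ j ∈ S.erase t, β a j = true := by
      intro j hj
      rw [hβa j (Finset.mem_of_mem_erase hj)]
      simpa using Finset.ne_of_mem_erase hj
    by_cases hjt : j = t
    · subst hjt
      simp only [mc, if_true]
      rw [hβa j htS, hβb j htS]
      rw [decide_eq_true this]
      simp
    · simp only [mc, if_neg hjt]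
      by_cases hj : j ∈ S
      · rw [hβa j hj, hβb j hj]; simp [hjt]
      · rw [hout a ha j hj, hout b hb j hj]
  have hMba : M (β b) = β a := by
    rw [← hMab, hMe, hMe]
    exact mc_mc (by simp) _
  refine ⟨β⁻¹ * M * β, ((hβ.inv.mul hM).mul hβ).mono (by omega), ?_⟩
  intro z hz
  simp only [Equiv.Perm.mul_apply]
  rw [Equiv.Perm.inv_eq_iff_eq]
  by_cases hza : z = a
  · subst hza; simp [hMab]
  by_cases hzb : z = b
  · subst hzb; simp [hMba]
  rw [Equiv.swap_apply_of_ne_of_ne hza hzb, hMe]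
  have hnot : ¬ ∀ j ∈ S.erase t, β z j = true := by
    intro hall
    cases hzt : β z t
    · apply hza
      apply β.injective
      funext j
      by_cases hj : j ∈ S
      · rw [hβa j hj]
        by_cases hjt : j = t
        · subst hjt; simp [hzt]
        · rw [hall j (Finset.mem_erase.mpr ⟨hjt, hj⟩)]; simp [hjt]
      · rw [hout a ha j hj, hout z hz j hj]
    · apply hzb
      apply β.injective
      funext j
      by_cases hj : j ∈ S
      · rw [hβb j hj]
        by_cases hjt : j = t
        · subst hjt; simp [hzt]
        · rw [hall j (Finset.mem_erase.mpr ⟨hjt, hj⟩)]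
      · rw [hout b hb j hj, hout z hz j hj]
  funext j
  simp only [mc, hnot]
  simp

theorem move_points {n : ℕ} {I : Type*} [DecidableEq I] (S D : Finset (Fin n))
    (hD : S.card ≤ D.card) (hSD : Disjoint S D)
    (p q : I → Fin n → Bool) (hp : Function.Injective p) (hq : Function.Injective q)
    (hpS : ∀ i, SuppIn S (p i)) (hqS : ∀ i, SuppIn S (q i)) (J : Finset I) :
    ∃ T : Equiv.Perm (Fin n → Bool), Rp T (J.card * (8 * S.card + 1)) ∧
      (∀ z, SuppIn S z → SuppIn S (T z)) ∧ ∀ i ∈ J, T (p i) = q i := by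
  induction J using Finset.induction_on with
  | empty => exact ⟨1, Rp.one.mono (by simp), by simp, by simp⟩
  | insert i J hi ih =>
    obtain ⟨T, hT, hTS, hTJ⟩ := ih
    rw [Finset.card_insert_of_notMem hi]
    by_cases hz : T (p i) = q i
    · refine ⟨T, Rf.mono hT (by gcongr; omega), hTS, ?_⟩
      intro j hj
      rcases Finset.mem_insert.mp hj with rfl | hj
      · exact hz
      · exact hTJ j hj
    · obtain ⟨U, hU, hUe⟩ := small_swap S D hD hSD _ _ (hTS _ (hpS i)) (hqS i) hz
      refine ⟨U * T, Rf.mono (hU.mul hT) (by rw [Nat.add_mul]; omega), ?_, ?_⟩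
      · intro z hzS
        rw [Equiv.Perm.mul_apply, hUe _ (hTS z hzS)]
        rw [Equiv.swap_apply_def]
        split_ifs
        · exact hqS i
        · exact hTS _ (hpS i)
        · exact hTS z hzS
      · intro j hj
        rw [Equiv.Perm.mul_apply, hUe _ (hTS _ (hpS j))]
        rcases Finset.mem_insert.mp hj with rfl | hj
        · simp
        · have hji : j ≠ i := fun h => hi (h ▸ hj)
          rw [hTJ j hj, Equiv.swap_apply_of_ne_of_ne]
          · rw [← hTJ j hj]
            exact fun h => hji (hp (T.injective h))
          · exact fun h => hji (hq h)

/-- `τ` is the product of the transpositions `(p (i, false), p (i, true))`. -/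
def IsFlip {X ι : Type*} (p : ι × Bool → X) (τ : Equiv.Perm X) : Prop :=
  (∀ i b, τ (p (i, b)) = p (i, !b)) ∧ ∀ z, z ∉ Set.range p → τ z = z

theorem dedupe {n : ℕ} {I : Type*} [Fintype I] [DecidableEq I] (p : I → Fin n → Bool) :
    ∃ (T : Equiv.Perm (Fin n → Bool)) (S : Finset (Fin n)), Rp T n ∧
      S.card ≤ 2 ^ Fintype.card I ∧ ∀ i, SuppIn S (T (p i)) := by
  classical
  let col : Fin n → (I → Bool) := fun j i => p i j
  have hr : ∀ j, ∃ j', col j' = col j := fun j => ⟨j, rfl⟩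
  have hrep : ∃ r : (I → Bool) → Option (Fin n), ∀ j, ∃ j', r (col j) = some j' ∧ col j' = col j := by
    refine ⟨fun v => if h : ∃ j, col j = v then some h.choose else none, ?_⟩
    intro j
    have h : ∃ j', col j' = col j := ⟨j, rfl⟩
    exact ⟨h.choose, by simp only [dif_pos h], h.choose_spec⟩
  obtain ⟨r, hr⟩ := hrep
  choose ρ hρ1 hρ2 using hr
  have hρρ : ∀ j, ρ (ρ j) = ρ j := by
    intro j
    have h := hρ1 (ρ j)
    rw [hρ2 j, hρ1 j] at h
    exact (Option.some.inj h).symm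
  let S : Finset (Fin n) := Finset.univ.filter fun j => ρ j = j
  have hL := Rf_layer (n := n) (fun j => {ρ j}) (Finset.univ \ S) (by
    intro j hj
    refine ⟨by simp, ?_⟩
    rw [Finset.disjoint_singleton_left]
    simp [S, hρρ])
  obtain ⟨T, hT, hTe⟩ := hL.perm
  refine ⟨T, S, Rf.mono hT (by simpa using Finset.card_le_univ (Finset.univ \ S)), ?_, ?_⟩
  · have : S.card ≤ (Finset.univ : Finset (I → Bool)).card := by
      apply Finset.card_le_card_of_injOn col (by simp)
      intro j hj j' hj' h
      have e1 : ρ j = j := by simpa [S] using hj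
      have e2 : ρ j' = j' := by simpa [S] using hj'
      have h1 := hρ1 j
      have h2 := hρ1 j'
      rw [h, h2, e1, e2] at h1
      exact (Option.some.inj h1).symm
    simpa using this
  · intro i j hj
    rw [hTe]
    have : p i (ρ j) = p i j := congrFun (hρ2 j) i
    simp [hj, this]

theorem flip_cost {n k : ℕ} (hk : 2 ≤ k) (hn : 2 ^ (8 * 2 ^ k) ≤ n)
    (p : (Fin k → Bool) × Bool → Fin n → Bool) (hp : Function.Injective p)
    (τ : Equiv.Perm (Fin n → Bool)) (hτ : IsFlip p τ) : Rp τ (26 * n) := by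
  classical
  obtain ⟨T, S₀, hT, hS₀, hTp⟩ := dedupe p
  set K := 2 ^ k with hK
  have hcI : Fintype.card ((Fin k → Bool) × Bool) = 2 * K := by
    simp [hK]; ring
  rw [hcI] at hS₀
  have hkK : k < K := Nat.lt_two_pow_self
  have hKK : K < 2 ^ K := Nat.lt_two_pow_self
  have hK4 : 4 ≤ K := by
    calc 4 = 2 ^ 2 := by norm_num
      _ ≤ 2 ^ k := Nat.pow_le_pow_right (by norm_num) hk
  have hKn : 8 * K < n := lt_of_lt_of_le Nat.lt_two_pow_self hn
  have hkn : k < n := by omega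
  let w : Fin n := ⟨k, hkn⟩
  let low : Finset (Fin n) := Finset.univ.filter fun j => (j : ℕ) ≤ k
  have hlow : low.card ≤ k + 1 := by
    have : low.card ≤ (Finset.range (k + 1)).card := by
      apply Finset.card_le_card_of_injOn (fun j : Fin n => (j : ℕ))
      · intro j hj
        have : (j : ℕ) ≤ k := by simpa [low] using hj
        simp; omega
      · intro a _ b _ h
        exact Fin.ext h
    simpa using this
  let S := S₀ ∪ low
  have hS : S.card ≤ 2 ^ (2 * K) + K := (Finset.card_union_le _ _).trans (by omega)
  have hS2 : S.card ≤ 2 * 2 ^ (2 * K) := by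
    have : K ≤ 2 ^ (2 * K) := hKK.le.trans (Nat.pow_le_pow_right (by norm_num) (by omega))
    omega
  have hpow : 2 * 2 ^ K * (17 * 2 ^ (2 * K)) ≤ n := by
    calc 2 * 2 ^ K * (17 * 2 ^ (2 * K)) ≤ 2 * 2 ^ K * (2 ^ 5 * 2 ^ (2 * K)) := by gcongr; norm_num
      _ = 2 ^ (3 * K + 6) := by ring
      _ ≤ 2 ^ (8 * K) := Nat.pow_le_pow_right (by norm_num) (by omega)
      _ ≤ n := hn
  have hone : 1 ≤ 2 ^ (2 * K) := Nat.one_le_two_pow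
  have hmove : 2 * K * (8 * S.card + 1) ≤ n := by
    refine le_trans ?_ hpow
    gcongr
    omega
  let D := Finset.univ \ S
  have hDS : S.card ≤ D.card := by
    have h1 : D.card = n - S.card := by
      simp [D, Finset.card_sdiff_of_subset (Finset.subset_univ S)]
    have : 8 * S.card + 1 ≤ n := le_trans (Nat.le_mul_of_pos_left _ (by omega)) hmove
    omega
  let q : Bool → (Fin k → Bool) × Bool → Fin n → Bool := fun c ib j =>
    if h : (j : ℕ) < k then ib.1 ⟨j, h⟩ else if (j : ℕ) = k then ib.2 else c
  have hq1 : ∀ c ib (j : Fin n) (h : (j : ℕ) < k), q c ib j = ib.1 ⟨j, h⟩ := by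
    intro c ib j h; simp [q, h]
  have hq2 : ∀ c ib (j : Fin n), (j : ℕ) = k → q c ib j = ib.2 := by
    intro c ib j h; simp [q, h]
  have hq3 : ∀ c ib (j : Fin n), k < (j : ℕ) → q c ib j = c := by
    intro c ib j h
    have h1 : ¬ (j : ℕ) < k := by omega
    have h2 : ¬ (j : ℕ) = k := by omega
    simp [q, h1, h2]
  have hqinj : ∀ c, Function.Injective (q c) := by
    intro c ib ib' h
    apply Prod.ext
    · funext i
      have := congrFun h ⟨i, i.2.trans hkn⟩
      rw [hq1 c ib _ i.2, hq1 c ib' _ i.2] at this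
      exact this
    · have := congrFun h w
      rw [hq2 c ib _ rfl, hq2 c ib' _ rfl] at this
      exact this
  have hp'S : ∀ i, SuppIn S (T (p i)) := fun i j hj => hTp i j (fun h => hj (Finset.mem_union_left _ h))
  have hqS : ∀ i, SuppIn S (q false i) := by
    intro i j hj
    apply hq3
    by_contra h
    exact hj (Finset.mem_union_right _ (by simp [low]; omega))
  obtain ⟨U, hU, -, hUe⟩ := move_points S D hDS Finset.disjoint_sdiff (fun i => T (p i)) (q false)
    (T.injective.comp hp) (hqinj false) hp'S hqS Finset.univ
  rw [Finset.card_univ, hcI] at hU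
  let high : Finset (Fin n) := Finset.univ.filter fun j => k < (j : ℕ)
  have hN := Rf_layer (n := n) (fun _ => ∅) high (by simp)
  have hhigh : high.card ≤ n := by simpa using Finset.card_le_univ high
  obtain ⟨N, hN, hNe⟩ := hN.perm
  have hNq : ∀ i, N (q false i) = q true i := by
    intro i
    rw [hNe]
    funext j
    by_cases hj : k < (j : ℕ)
    · simp [high, hj, hq3 _ _ _ hj]
    · simp only [high, hj, Finset.mem_filter, Finset.mem_univ, true_and, if_false]
      rcases Nat.lt_or_ge j k with h | h
      · rw [hq1 _ _ _ h, hq1 _ _ _ h]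
      · rw [hq2 _ _ _ (by omega), hq2 _ _ _ (by omega)]
  have hM := Rf_mc_big high w ⟨0, by omega⟩ ⟨1, by omega⟩ (by simp [high, w]) (by simp [high])
    (by simp [high]; omega) (by simp [w]; omega) (by simp [w]; omega) (by simp)
  obtain ⟨M, hM, hMe⟩ := hM.perm
  set α := N * U * T with hα
  have hαR : Rp α (3 * n) := Rf.mono ((hN.mul hU).mul hT) (by omega)
  have hαp : ∀ i, α (p i) = q true i := by
    intro i
    simp only [hα, Equiv.Perm.mul_apply]
    rw [hUe i (Finset.mem_univ _), hNq]
  have hMq : ∀ i b, M (q true (i, b)) = q true (i, !b) := by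
    intro i b
    rw [hMe]
    have hall : ∀ j ∈ high, q true (i, b) j = true := by
      intro j hj
      exact hq3 _ _ _ (by simpa [high] using hj)
    funext j
    by_cases hj : j = w
    · subst hj
      simp only [mc, if_true]
      rw [hq2 _ _ _ rfl, hq2 _ _ _ rfl]
      rw [decide_eq_true hall]
      simp
    · simp only [mc, if_neg hj]
      rcases Nat.lt_trichotomy j k with h | h | h
      · rw [hq1 _ _ _ h, hq1 _ _ _ h]
      · exact absurd (Fin.ext h) hj
      · rw [hq3 _ _ _ h, hq3 _ _ _ h]
  have hMz : ∀ z, z ∉ Set.range (q true) → M z = z := by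
    intro z hz
    rw [hMe]
    have hnot : ¬ ∀ j ∈ high, z j = true := by
      intro hall
      apply hz
      refine ⟨(fun i => z ⟨i, i.2.trans hkn⟩, z w), ?_⟩
      funext j
      rcases Nat.lt_trichotomy j k with h | h | h
      · rw [hq1 _ _ _ h]
      · rw [hq2 _ _ _ h]
        have : w = j := Fin.ext h.symm
        rw [this]
      · rw [hq3 _ _ _ h, hall j (by simp [high, h])]
    funext j
    simp only [mc, hnot]
    simp
  have : τ = α⁻¹ * M * α := by
    ext1 z
    simp only [Equiv.Perm.mul_apply]
    symm
    rw [Equiv.Perm.inv_eq_iff_eq]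
    by_cases hz : z ∈ Set.range p
    · obtain ⟨⟨i, b⟩, rfl⟩ := hz
      rw [hτ.1, hαp, hαp, hMq]
    · rw [hτ.2 z hz]
      apply hMz
      rintro ⟨i, hi⟩
      rw [← hαp] at hi
      exact hz ⟨i, α.injective hi⟩
  rw [this]
  exact Rf.mono ((hαR.inv.mul hM).mul hαR) (by omega)

end RevCirc

namespace RevCirc

theorem exists_flip {X ι : Type*} (p : ι × Bool → X) (hp : Function.Injective p) :
    ∃ τ : Equiv.Perm X, IsFlip p τ := by
  classical
  let e : Equiv.Perm (ι × Bool) := Equiv.prodCongr (Equiv.refl ι) Equiv.boolNot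
  refine ⟨e.viaEmbedding ⟨p, hp⟩, ?_, ?_⟩
  · intro i b
    exact Equiv.Perm.viaEmbedding_apply e ⟨p, hp⟩ (i, b)
  · intro z hz
    exact Equiv.Perm.viaEmbedding_apply_of_notMem e ⟨p, hp⟩ z hz

theorem exists_flip_extend {X ι : Type*} [DecidableEq X] [DecidableEq ι] (i₀ : ι)
    (ρ : {i : ι // i ≠ i₀} × Bool → X) (hρ : Function.Injective ρ) (u v : X) (huv : u ≠ v)
    (hu : u ∉ Set.range ρ) (hv : v ∉ Set.range ρ) :
    ∃ (p : ι × Bool → X) (τ : Equiv.Perm X), Function.Injective p ∧ IsFlip p τ ∧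
      (∀ i b, τ (ρ (i, b)) = ρ (i, !b)) ∧ ∀ z, z ∉ Set.range ρ → τ z = Equiv.swap u v z := by
  let p : ι × Bool → X := fun ib =>
    if h : ib.1 = i₀ then (if ib.2 then v else u) else ρ (⟨ib.1, h⟩, ib.2)
  have hp0 : ∀ b, p (i₀, b) = if b then v else u := by intro b; simp [p]
  have hp1 : ∀ (i : {i : ι // i ≠ i₀}) b, p (i.1, b) = ρ (i, b) := by
    intro i b; simp [p, i.2]
  have hin : ∀ b, p (i₀, b) ∉ Set.range ρ := by
    intro b
    rw [hp0]
    cases b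
    · exact hu
    · exact hv
  have hp : Function.Injective p := by
    rintro ⟨i, b⟩ ⟨i', b'⟩ h
    by_cases hi : i = i₀ <;> by_cases hi' : i' = i₀
    · subst hi; subst hi'
      rw [hp0, hp0] at h
      cases b <;> cases b' <;> simp_all
    · subst hi
      have := hp1 ⟨i', hi'⟩ b'
      exact absurd ⟨_, (h.trans this).symm⟩ (hin b)
    · subst hi'
      have := hp1 ⟨i, hi⟩ b
      exact absurd ⟨_, (h.symm.trans this).symm⟩ (hin b')
    · have h1 := hp1 ⟨i, hi⟩ b
      have h2 := hp1 ⟨i', hi'⟩ b'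
      have := hρ (h1.symm.trans (h.trans h2))
      simpa using this
  obtain ⟨τ, hτ⟩ := exists_flip p hp
  refine ⟨p, τ, hp, hτ, ?_, ?_⟩
  · intro i b
    rw [← hp1, hτ.1, hp1]
  · intro z hz
    by_cases h1 : z = u
    · subst h1
      have := hτ.1 i₀ false
      rw [hp0, hp0] at this
      simpa using this
    by_cases h2 : z = v
    · subst h2
      have := hτ.1 i₀ true
      rw [hp0, hp0] at this
      simpa using this
    rw [Equiv.swap_apply_of_ne_of_ne h1 h2]
    apply hτ.2
    rintro ⟨⟨i, b⟩, hib⟩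
    by_cases hi : i = i₀
    · subst hi
      rw [hp0] at hib
      cases b
      · exact h1 (by simpa using hib.symm)
      · exact h2 (by simpa using hib.symm)
    · exact hz ⟨_, (hp1 ⟨i, hi⟩ b).symm.trans hib⟩

theorem three_cycle {n T : ℕ} {ι : Type} [Fintype ι] [DecidableEq ι] [Nonempty ι]
    (hcard : 2 * Fintype.card ι + 1 ≤ 2 ^ n)
    (hfl : ∀ (p : ι × Bool → Fin n → Bool) (τ : Equiv.Perm (Fin n → Bool)),
      Function.Injective p → IsFlip p τ → Rp τ T)
    (a b c : Fin n → Bool) (hab : a ≠ b) (hbc : b ≠ c) :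
    Rp (Equiv.swap a b * Equiv.swap b c) (2 * T) := by
  classical
  obtain ⟨i₀⟩ := ‹Nonempty ι›
  have hemb : Nonempty ({i : ι // i ≠ i₀} × Bool ↪ {z : Fin n → Bool // z ∉ ({a, b, c} : Finset (Fin n → Bool))}) := by
    apply Function.Embedding.nonempty_of_card_le
    rw [Fintype.card_prod, Fintype.card_bool, Fintype.card_subtype_compl, Fintype.card_subtype_eq]
    have h1 : Fintype.card {z : Fin n → Bool // z ∉ ({a, b, c} : Finset (Fin n → Bool))} =
        2 ^ n - ({a, b, c} : Finset (Fin n → Bool)).card := by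
      rw [Fintype.card_subtype_compl, Fintype.card_coe]
      simp
    have h2 := Finset.card_le_three (a := a) (b := b) (c := c)
    rw [h1]
    omega
  obtain ⟨ρ'⟩ := hemb
  let ρ : {i : ι // i ≠ i₀} × Bool → Fin n → Bool := fun i => (ρ' i).1
  have hρ : Function.Injective ρ := Subtype.val_injective.comp ρ'.injective
  have hout : ∀ z, z ∈ ({a, b, c} : Finset (Fin n → Bool)) → z ∉ Set.range ρ := by
    rintro z hz ⟨i, rfl⟩
    exact (ρ' i).2 hz
  have ha := hout a (by simp)
  have hb := hout b (by simp)
  have hc := hout c (by simp)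
  obtain ⟨p1, τ1, hp1, hf1, h11, h12⟩ := exists_flip_extend i₀ ρ hρ a b hab ha hb
  obtain ⟨p2, τ2, hp2, hf2, h21, h22⟩ := exists_flip_extend i₀ ρ hρ b c hbc hb hc
  have : Equiv.swap a b * Equiv.swap b c = τ1 * τ2 := by
    ext1 z
    simp only [Equiv.Perm.mul_apply]
    by_cases hz : z ∈ Set.range ρ
    · obtain ⟨⟨i, s⟩, rfl⟩ := hz
      rw [h21, h11, Bool.not_not]
      have hne : ∀ w, w ∉ Set.range ρ → ρ (i, s) ≠ w := fun w hw h => hw ⟨_, h⟩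
      rw [Equiv.swap_apply_of_ne_of_ne (hne b hb) (hne c hc),
        Equiv.swap_apply_of_ne_of_ne (hne a ha) (hne b hb)]
    · rw [h22 z hz, h12]
      rw [Equiv.swap_apply_def]
      split_ifs
      · exact hc
      · exact hb
      · exact hz
  rw [this]
  exact Rf.mono ((hfl p1 τ1 hp1 hf1).mul (hfl p2 τ2 hp2 hf2)) (by omega)

theorem small_support {n T : ℕ} {ι : Type} [Fintype ι] [DecidableEq ι] [Nonempty ι] (hn : 4 ≤ n)
    (hcard : 2 * Fintype.card ι + 1 ≤ 2 ^ n)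
    (hfl : ∀ (p : ι × Bool → Fin n → Bool) (τ : Equiv.Perm (Fin n → Bool)),
      Function.Injective p → IsFlip p τ → Rp τ T)
    (s : ℕ) (σ : Equiv.Perm (Fin n → Bool)) (hs : σ.support.card ≤ s)
    (hsign : Equiv.Perm.sign σ = 1) : Rp σ (s * (2 * T)) := by
  induction s generalizing σ with
  | zero =>
    have : σ = 1 := by simpa using hs
    rw [this]
    exact Rf.mono Rp.one (by simp)
  | succ s ih =>
    by_cases h1 : σ = 1
    · rw [h1]
      exact Rf.mono Rp.one (by simp)
    have h2 : σ.support.card ≠ 2 := by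
      intro h
      have h3 := Equiv.Perm.card_support_eq_two.mp h
      have := h3.sign_eq
      rw [hsign] at this
      exact absurd this (by decide)
    have h3 := Equiv.Perm.two_le_card_support_of_ne_one h1
    obtain ⟨x, hx⟩ : ∃ x, x ∈ σ.support := by
      apply Finset.Nonempty.exists_mem
      rw [← Finset.card_pos]
      omega
    have hy : σ x ∈ σ.support := Equiv.Perm.apply_mem_support.mpr hx
    have hxy : σ x ≠ x := Equiv.Perm.mem_support.mp hx
    have hlt : ({x, σ x} : Finset (Fin n → Bool)).card < σ.support.card := by
      have := Finset.card_le_two (a := x) (b := σ x)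
      omega
    obtain ⟨z, hz, hz'⟩ := Finset.exists_mem_notMem_of_card_lt_card hlt
    simp only [Finset.mem_insert, Finset.mem_singleton, not_or] at hz'
    have hR := three_cycle hcard hfl z (σ x) x hz'.2 hxy
    set c := Equiv.swap z (σ x) * Equiv.swap (σ x) x with hc
    have hsub : (c * σ).support ⊆ σ.support.erase x := by
      intro w hw
      rw [Equiv.Perm.mem_support] at hw
      rw [Finset.mem_erase]
      constructor
      · rintro rfl
        apply hw
        simp only [hc, Equiv.Perm.mul_apply]
        rw [Equiv.swap_apply_left, Equiv.swap_apply_of_ne_of_ne (Ne.symm hz'.1) (Ne.symm hxy)]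
      · by_contra hw'
        have hws : σ w = w := by simpa using hw'
        have hne : ∀ v ∈ σ.support, w ≠ v := by
          rintro v hv rfl
          exact Equiv.Perm.mem_support.mp hv hws
        apply hw
        simp only [hc, Equiv.Perm.mul_apply]
        rw [hws, Equiv.swap_apply_of_ne_of_ne (hne _ hy) (hne _ hx),
          Equiv.swap_apply_of_ne_of_ne (hne _ hz) (hne _ hy)]
    have hcs : (c * σ).support.card ≤ s := by
      have := Finset.card_le_card hsub
      rw [Finset.card_erase_of_mem hx] at this
      omega
    have hih := ih (c * σ) hcs (by rw [map_mul, hsign, hR.sign hn]; simp)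
    have : σ = c⁻¹ * (c * σ) := by group
    rw [this]
    exact Rf.mono (hR.inv.mul hih) (by rw [Nat.add_mul]; omega)

theorem exists_indep {X : Type*} [Fintype X] [DecidableEq X] (σ : Equiv.Perm X) (K : ℕ)
    (h : 3 * K ≤ σ.support.card) :
    ∃ Y : Finset X, Y ⊆ σ.support ∧ Y.card = K ∧ ∀ x ∈ Y, σ x ∉ Y := by
  induction K with
  | zero => exact ⟨∅, by simp, by simp, by simp⟩
  | succ K ih =>
    obtain ⟨Y, hY, hc, hi⟩ := ih (by omega)
    have hlt : (Y ∪ Y.image σ ∪ Y.image σ.symm).card < σ.support.card := by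
      have h1 := Finset.card_union_le (Y ∪ Y.image σ) (Y.image σ.symm)
      have h2 := Finset.card_union_le Y (Y.image σ)
      have h3 := Finset.card_image_le (s := Y) (f := σ)
      have h4 := Finset.card_image_le (s := Y) (f := σ.symm)
      omega
    obtain ⟨z, hz, hz'⟩ := Finset.exists_mem_notMem_of_card_lt_card hlt
    simp only [Finset.mem_union, not_or] at hz'
    obtain ⟨⟨h1, h2⟩, h3⟩ := hz'
    refine ⟨insert z Y, Finset.insert_subset hz hY, by rw [Finset.card_insert_of_notMem h1, hc], ?_⟩
    intro x hx hx'
    rcases Finset.mem_insert.mp hx with rfl | hx <;> rcases Finset.mem_insert.mp hx' with h | h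
    · exact Equiv.Perm.mem_support.mp hz h
    · exact h3 (Finset.mem_image.mpr ⟨_, h, by simp⟩)
    · exact h2 (Finset.mem_image.mpr ⟨_, hx, h⟩)
    · exact hi x hx h

theorem all_even {n T : ℕ} {ι : Type} [Fintype ι] [DecidableEq ι] [Nonempty ι] (hn : 4 ≤ n)
    (hcard : 2 * Fintype.card ι + 1 ≤ 2 ^ n)
    (hfl : ∀ (p : ι × Bool → Fin n → Bool) (τ : Equiv.Perm (Fin n → Bool)),
      Function.Injective p → IsFlip p τ → Rp τ T)
    (m : ℕ) (σ : Equiv.Perm (Fin n → Bool))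
    (hs : σ.support.card ≤ 3 * Fintype.card ι + m * Fintype.card ι)
    (hsign : Equiv.Perm.sign σ = 1) : Rp σ (m * T + 3 * Fintype.card ι * (2 * T)) := by
  induction m generalizing σ with
  | zero =>
    exact Rf.mono (small_support hn hcard hfl _ σ (by simpa using hs) hsign) (by simp)
  | succ m ih =>
    by_cases hlt : 3 * Fintype.card ι ≤ σ.support.card
    · obtain ⟨Y, hY, hc, hi⟩ := exists_indep σ _ hlt
      have hcY : Fintype.card ι = Fintype.card Y := by simp [hc]
      let e : ι ≃ Y := Fintype.equivOfCardEq hcY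
      let p : ι × Bool → Fin n → Bool := fun ib => if ib.2 then σ (e ib.1) else (e ib.1).1
      have hp : Function.Injective p := by
        rintro ⟨i, b⟩ ⟨i', b'⟩ h
        cases b <;> cases b' <;> simp [p] at h
        · simpa using h
        · exact absurd (h ▸ (e i).2) (hi _ (e i').2)
        · exact absurd (h ▸ (e i').2) (hi _ (e i).2)
        · simpa using h
      obtain ⟨τ, hτ⟩ := exists_flip p hp
      have hR := hfl p τ hp hτ
      have hτY : ∀ x ∈ Y, τ (σ x) = x := by
        intro x hx
        have := hτ.1 (e.symm ⟨x, hx⟩) true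
        simpa [p] using this
      have hsub : (τ * σ).support ⊆ σ.support \ Y := by
        intro w hw
        rw [Equiv.Perm.mem_support, Equiv.Perm.mul_apply] at hw
        rw [Finset.mem_sdiff]
        refine ⟨?_, fun h => hw (hτY w h)⟩
        by_contra hw'
        have hws : σ w = w := by simpa using hw'
        apply hw
        rw [hws]
        apply hτ.2
        rintro ⟨⟨i, b⟩, h⟩
        have hmem : (e i).1 ∈ σ.support := hY (e i).2
        cases b
        · simp [p] at h
          exact hw' (h ▸ hmem)
        · simp [p] at h
          exact hw' (h ▸ Equiv.Perm.apply_mem_support.mpr hmem)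
      have hcs := Finset.card_le_card hsub
      rw [Finset.card_sdiff_of_subset hY, hc] at hcs
      have hih := ih (τ * σ) (by rw [Nat.add_mul] at hs; omega)
        (by rw [map_mul, hsign, hR.sign hn]; simp)
      have : σ = τ⁻¹ * (τ * σ) := by group
      rw [this]
      exact Rf.mono (hR.inv.mul hih) (by rw [Nat.add_mul]; omega)
    · exact Rf.mono (ih σ (by omega) hsign) (by rw [Nat.add_mul]; omega)

theorem even_cost {n k : ℕ} (hk : 2 ≤ k) (hn : 2 ^ (8 * 2 ^ k) ≤ n)
    (σ : Equiv.Perm (Fin n → Bool)) (hsign : Equiv.Perm.sign σ = 1) :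
    Rp σ ((2 ^ (n - k) + 6 * 2 ^ k) * (26 * n)) := by
  have hkK : k < 2 ^ k := Nat.lt_two_pow_self
  have hKn : 8 * 2 ^ k < n := lt_of_lt_of_le Nat.lt_two_pow_self hn
  have hnn : n < 2 ^ n := Nat.lt_two_pow_self
  have hc : Fintype.card (Fin k → Bool) = 2 ^ k := by simp
  have := all_even (n := n) (T := 26 * n) (ι := Fin k → Bool) (by omega) (by rw [hc]; omega)
    (fun p τ hp hτ => flip_cost hk hn p hp τ hτ) (2 ^ (n - k)) σ ?_ hsign
  · rw [hc] at this
    exact Rf.mono this (le_of_eq (by ring))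
  · rw [hc, ← pow_add, Nat.sub_add_cancel (by omega)]
    have := Finset.card_le_univ σ.support
    simp at this
    omega

end RevCirc

namespace RevCirc

theorem expand_zero {n : ℕ} (x : Fin n → Bool) : expand n 0 x = x := by
  funext i
  have : (i : ℕ) < n := i.2
  simp [expand]

theorem Lmin_le {n B : ℕ} (hn : 4 ≤ n)
    (hB : ∀ σ : Equiv.Perm (Fin n → Bool), Equiv.Perm.sign σ = 1 → Rp σ B)
    (f : (Fin n → Bool) → (Fin n → Bool)) (hf : f ∈ FSet n 0) : Lmin n 0 f ≤ B := by
  obtain ⟨c, π, h⟩ := hf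
  obtain ⟨c', hc', hl⟩ := hB (circPerm (n := n) c) (sign_circ hn c _ (fun x => rfl))
  refine le_trans (Nat.sInf_le ⟨c', ⟨π, ?_⟩, rfl⟩) hl
  intro x i
  rw [← h x i]
  have : ∀ y, evalCircuit (n := n) c' y = evalCircuit (n := n) c y := fun y => congrFun hc' y
  exact congrFun (this _) _

theorem upper_bound {n B : ℕ} (hn : 4 ≤ n)
    (hB : ∀ σ : Equiv.Perm (Fin n → Bool), Equiv.Perm.sign σ = 1 → Rp σ B) :
    ShannonL n 0 ≤ B := by
  apply csSup_le'
  rintro _ ⟨f, hf, rfl⟩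
  exact Lmin_le hn hB f hf

theorem exists_short {n B : ℕ} (hn : 4 ≤ n)
    (hB : ∀ σ : Equiv.Perm (Fin n → Bool), Equiv.Perm.sign σ = 1 → Rp σ B)
    (σ : Equiv.Perm (Fin n → Bool)) (hσ : Equiv.Perm.sign σ = 1) :
    ∃ (c : List (Gate n)) (π : Equiv.Perm (Fin n)), c.length ≤ ShannonL n 0 ∧
      ∀ x i, evalCircuit c x (π i) = σ x i := by
  have hmem : (σ : (Fin n → Bool) → (Fin n → Bool)) ∈ FSet n 0 := by
    obtain ⟨c, hc, -⟩ := hB σ hσ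
    refine ⟨c, 1, ?_⟩
    intro x i
    rw [← hc, expand_zero]
    rfl
  have hle : Lmin n 0 σ ≤ ShannonL n 0 := by
    apply le_csSup
    · refine ⟨B, ?_⟩
      rintro _ ⟨f, hf, rfl⟩
      exact Lmin_le hn hB f hf
    · exact ⟨_, hmem, rfl⟩
  have hne : {l | ∃ c : List (Gate (n + 0)), implements n 0 c σ ∧ c.length = l}.Nonempty := by
    obtain ⟨c, hc⟩ := hmem
    exact ⟨_, c, hc, rfl⟩
  obtain ⟨c, ⟨π, hπ⟩, hl⟩ := Nat.sInf_mem hne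
  refine ⟨c, π, ?_, ?_⟩
  · rw [hl]; exact hle
  · intro x i
    rw [← hπ x i, expand_zero]
    rfl

theorem card_gate (n : ℕ) : Fintype.card (Gate n) ≤ n ^ 3 := by
  classical
  have hs : ∀ g : Gate n, ∃ tab : Fin n × Fin n × Fin n,
      tab.1 = g.1.1 ∧ ({tab.2.1, tab.2.2} : Finset (Fin n)).erase tab.1 = g.1.2 := by
    rintro ⟨⟨t, C⟩, hC, ht⟩
    simp only at hC ht
    have h3 : C.card = 0 ∨ C.card = 1 ∨ C.card = 2 := by omega
    rcases h3 with h | h | h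
    · refine ⟨(t, t, t), rfl, ?_⟩
      rw [Finset.card_eq_zero] at h
      simp [h]
    · obtain ⟨a, rfl⟩ := Finset.card_eq_one.mp h
      refine ⟨(t, a, a), rfl, ?_⟩
      simp only [Finset.pair_eq_singleton]
      exact Finset.erase_eq_of_notMem ht
    · obtain ⟨a, b, -, rfl⟩ := Finset.card_eq_two.mp h
      exact ⟨(t, a, b), rfl, Finset.erase_eq_of_notMem ht⟩
  choose g hg1 hg2 using hs
  have hinj : Function.Injective g := by
    intro a b h
    apply Subtype.ext
    apply Prod.ext
    · rw [← hg1 a, ← hg1 b, h]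
    · rw [← hg2 a, ← hg2 b, h]
  have := Fintype.card_le_of_injective g hinj
  refine this.trans (le_of_eq ?_)
  simp; ring

theorem count_bound {n B : ℕ} (hn : 4 ≤ n)
    (hB : ∀ σ : Equiv.Perm (Fin n → Bool), Equiv.Perm.sign σ = 1 → Rp σ B) :
    (2 ^ n).factorial ≤ 2 * ((n ^ 3 + 1) ^ (ShannonL n 0) * n.factorial) := by
  classical
  have h : ∀ σ : alternatingGroup (Fin n → Bool), ∃ cp : List (Gate n) × Equiv.Perm (Fin n),
      cp.1.length ≤ ShannonL n 0 ∧ ∀ x i, evalCircuit cp.1 x (cp.2 i) = σ.1 x i := by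
    intro σ
    obtain ⟨c, π, h1, h2⟩ := exists_short hn hB σ.1 (Equiv.Perm.mem_alternatingGroup.mp σ.2)
    exact ⟨(c, π), h1, h2⟩
  choose g hg1 hg2 using h
  let F : alternatingGroup (Fin n → Bool) → (Fin (ShannonL n 0) → Option (Gate n)) × Equiv.Perm (Fin n) :=
    fun σ => (fun i => (g σ).1[(i : ℕ)]?, (g σ).2)
  have hF : Function.Injective F := by
    intro σ τ hst
    have h1 : (g σ).1 = (g τ).1 := by
      apply List.ext_getElem?
      intro i
      by_cases hi : i < ShannonL n 0
      · exact congrFun (congrArg Prod.fst hst) ⟨i, hi⟩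
      · rw [List.getElem?_eq_none (by have := hg1 σ; omega),
          List.getElem?_eq_none (by have := hg1 τ; omega)]
    have h2 : (F σ).2 = (F τ).2 := congrArg Prod.snd hst
    have h2 : (g σ).2 = (g τ).2 := h2
    apply Subtype.ext
    ext1 x
    funext i
    rw [← hg2 σ, ← hg2 τ, h1, h2]
  have hcard := Fintype.card_le_of_injective F hF
  have : Nonempty (Fin n) := ⟨⟨0, by omega⟩⟩
  have h2 := two_mul_card_alternatingGroup (α := Fin n → Bool)
  rw [Fintype.card_perm] at h2
  have hV : Fintype.card (Fin n → Bool) = 2 ^ n := by simp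
  rw [hV] at h2
  rw [← h2]
  refine Nat.mul_le_mul_left 2 (hcard.trans ?_)
  rw [Fintype.card_prod, Fintype.card_perm, Fintype.card_fun, Fintype.card_fin, Fintype.card_fin,
    Fintype.card_option]
  gcongr
  exact card_gate n

theorem main_nat {n : ℕ} (hn : 2 ^ 64 ≤ n) :
    ∃ K : ℕ, 4 ≤ K ∧ K ≤ n ∧ Real.logb 2 n ≤ 16 * K ∧
      K * ShannonL n 0 ≤ (2 ^ n + 6 * K ^ 2) * (26 * n) ∧
      (2 ^ n).factorial ≤ 2 * ((n ^ 3 + 1) ^ (ShannonL n 0) * n.factorial) := by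
  set l := Nat.log 2 n with hl
  have h64 : 64 ≤ l := (Nat.le_log_iff_pow_le (by norm_num) (by omega)).mpr hn
  set r := Nat.log 2 l with hr
  have hr6 : 6 ≤ r := (Nat.le_log_iff_pow_le (by norm_num) (by omega)).mpr (by norm_num; omega)
  obtain ⟨k, hk⟩ : ∃ k, r = k + 3 := ⟨r - 3, by omega⟩
  have h1 : 2 ^ r ≤ l := Nat.pow_log_le_self 2 (by omega)
  have h2 : l < 2 ^ (r + 1) := Nat.lt_pow_succ_log_self (by norm_num) l
  rw [hk] at h1 h2
  have e1 : 2 ^ (k + 3) = 8 * 2 ^ k := by ring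
  have e2 : 2 ^ (k + 3 + 1) = 16 * 2 ^ k := by ring
  rw [e1] at h1
  rw [e2] at h2
  have h3 : 2 ^ l ≤ n := Nat.pow_log_le_self 2 (by omega)
  have h4 : n < 2 ^ (l + 1) := Nat.lt_pow_succ_log_self (by norm_num) n
  have hn' : 2 ^ (8 * 2 ^ k) ≤ n := (Nat.pow_le_pow_right (by norm_num) h1).trans h3
  have hk2 : 2 ≤ k := by omega
  have hKn : 8 * 2 ^ k < n := lt_of_lt_of_le Nat.lt_two_pow_self hn'
  have hkK : k < 2 ^ k := Nat.lt_two_pow_self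
  have hB := fun σ hσ => even_cost (n := n) hk2 hn' σ hσ
  have hK4 : 4 ≤ 2 ^ k := by
    calc 4 = 2 ^ 2 := by norm_num
      _ ≤ 2 ^ k := Nat.pow_le_pow_right (by norm_num) hk2
  refine ⟨2 ^ k, hK4, by omega, ?_, ?_, count_bound (by omega) hB⟩
  · have hnp : (0 : ℝ) < n := by
      have : 0 < n := by omega
      exact_mod_cast this
    rw [Real.logb_le_iff_le_rpow (by norm_num) hnp]
    have : n ≤ 2 ^ (16 * 2 ^ k) := h4.le.trans (Nat.pow_le_pow_right (by norm_num) h2)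
    have h' : (n : ℝ) ≤ 2 ^ (16 * 2 ^ k) := by exact_mod_cast this
    refine h'.trans (le_of_eq ?_)
    rw [← Real.rpow_natCast]
    push_cast
    rfl
  · have hu := upper_bound (n := n) (by omega) hB
    calc 2 ^ k * ShannonL n 0 ≤ 2 ^ k * ((2 ^ (n - k) + 6 * 2 ^ k) * (26 * n)) := by gcongr
      _ = (2 ^ (n - k + k) + 6 * (2 ^ k) ^ 2) * (26 * n) := by rw [pow_add]; ring
      _ = _ := by rw [Nat.sub_add_cancel (by omega)]

theorem fact_bound (n : ℕ) : 2 ^ (n * 2 ^ n) ≤ (2 ^ (n + 1)).factorial := by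
  have h := @Nat.factorial_mul_pow_le_factorial (2 ^ n) (2 ^ n)
  have e : 2 ^ n + 2 ^ n = 2 ^ (n + 1) := by ring
  rw [e] at h
  refine le_trans ?_ h
  rw [pow_mul]
  calc (2 ^ n) ^ (2 ^ n) ≤ (2 ^ n + 1) ^ (2 ^ n) := by gcongr; omega
    _ ≤ _ := Nat.le_mul_of_pos_left _ (Nat.factorial_pos _)

theorem lower_real {n L : ℕ} (hn : 64 ≤ n)
    (h : (2 ^ n).factorial ≤ 2 * ((n ^ 3 + 1) ^ L * n.factorial)) :
    ((n : ℝ) - 1) * 2 ^ n / 2 ≤ 1 + (4 * L + n) * Real.logb 2 n := by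
  obtain ⟨m, rfl⟩ : ∃ m, n = m + 1 := ⟨n - 1, by omega⟩
  have h0 := (fact_bound m).trans h
  have h1 : 2 * (((m + 1) ^ 3 + 1) ^ L * (m + 1).factorial) ≤ 2 * (m + 1) ^ (4 * L + (m + 1)) := by
    rw [pow_add, pow_mul]
    gcongr
    · nlinarith [Nat.one_le_pow 3 (m + 1) (by omega)]
    · exact Nat.factorial_le_pow (m + 1)
  have h2 : 2 ^ (m * 2 ^ m) ≤ 2 * (m + 1) ^ (4 * L + (m + 1)) := h0.trans h1
  have h3 : (2 : ℝ) ^ (m * 2 ^ m) ≤ 2 * ((m + 1 : ℕ) : ℝ) ^ (4 * L + (m + 1)) := by exact_mod_cast h2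
  have hpos : (0 : ℝ) < ((m + 1 : ℕ) : ℝ) := by positivity
  have h4 := Real.logb_le_logb_of_le (b := 2) (by norm_num) (by positivity) h3
  rw [Real.logb_mul (by norm_num) (by positivity), Real.logb_pow, Real.logb_pow,
    Real.logb_self_eq_one (by norm_num)] at h4
  push_cast at h4 ⊢
  rw [pow_succ]
  linarith

end RevCirc

/-- Theorem: `L(n,0) ≍ n·2ⁿ/log₂ n`. -/
theorem shannonL_asymptotics :
    ∃ c₁ c₂ : ℝ, 0 < c₁ ∧ 0 < c₂ ∧ ∃ n₀ : ℕ, ∀ n : ℕ, n > n₀ →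
      c₁ * n * 2 ^ n / Real.logb 2 n ≤ (RevCirc.ShannonL n 0 : ℝ) ∧
      (RevCirc.ShannonL n 0 : ℝ) ≤ c₂ * n * 2 ^ n / Real.logb 2 n := by
  refine ⟨1 / 32, 26 * 16 * 7, by norm_num, by norm_num, 2 ^ 64, ?_⟩
  intro n hn
  obtain ⟨K, hK4, hKn, hlog, hup, hlow⟩ := RevCirc.main_nat (n := n) hn.le
  set L := RevCirc.ShannonL n 0
  have hn64 : 64 ≤ n := le_trans (by norm_num) hn.le
  have hlo := RevCirc.lower_real hn64 hlow
  have hnr : (64 : ℝ) ≤ n := by exact_mod_cast hn64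
  have hlpos : 0 < Real.logb 2 n := Real.logb_pos (by norm_num) (by linarith)
  have hnlt : n < 2 ^ n := Nat.lt_two_pow_self
  have hln : Real.logb 2 n ≤ n := by
    rw [Real.logb_le_iff_le_rpow (by norm_num) (by linarith), Real.rpow_natCast]
    exact_mod_cast hnlt.le
  have hsq : 64 * n ≤ 2 ^ n := by
    clear * - hn64
    induction n, hn64 using Nat.le_induction with
    | base => norm_num
    | succ n hn ih => rw [pow_succ]; omega
  have hsqr : 64 * (n : ℝ) ≤ 2 ^ n := by exact_mod_cast hsq
  have hsq2 : n ^ 2 ≤ 2 ^ n := by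
    clear * - hn64
    induction n, hn64 using Nat.le_induction with
    | base => norm_num
    | succ n hn ih => rw [pow_succ 2 n]; nlinarith
  constructor
  · rw [div_le_iff₀ hlpos]
    have h1 : (n : ℝ) * Real.logb 2 n ≤ n * n := by gcongr
    have h2 : (n : ℝ) * n * 64 ≤ n * 2 ^ n := by nlinarith
    have h3 : (64 : ℝ) * 2 ^ n ≤ n * 2 ^ n := by gcongr
    have h4 : (1 : ℝ) ≤ 2 ^ n := one_le_pow₀ (by norm_num)
    nlinarith
  · rw [le_div_iff₀ hlpos]
    have hK : (0 : ℝ) < K := by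
      have : 0 < K := by omega
      exact_mod_cast this
    have hup2 : K * L ≤ (7 * 2 ^ n) * (26 * n) := by
      refine hup.trans ?_
      have : K ^ 2 ≤ n ^ 2 := Nat.pow_le_pow_left hKn 2
      gcongr
      omega
    have hup3 : (K : ℝ) * L ≤ (7 * 2 ^ n) * (26 * n) := by exact_mod_cast hup2
    calc (L : ℝ) * Real.logb 2 n ≤ L * (16 * K) := by gcongr
      _ = 16 * (K * L) := by ring
      _ ≤ 16 * ((7 * 2 ^ n) * (26 * n)) := by gcongr
      _ = _ := by ring
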